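/- Suppose Assumptions 1 and 2 hold and that (Ω, F_t, P) is atomless for every t ∈ 𝕋, where 𝕋 = {t_1, …, t_r} with 0 < t_1 < ⋯ < t_r = T is a finite time grid. Then for every randomized stopping density (f_t)_{t∈𝕋} ∈ P^∞_𝕋 and every finite subset S_N ⊆ S of N scenarios, there exists a partition (A^N_t)_{t∈𝕋} ∈ P_𝕋 such that E^θ[f_t Y_t] = E^θ[1_{A^N_t} Y_t] for every t ∈ 𝕋 and every θ ∈ S_N. -/

import Mathlib

open MeasureTheory ProbabilityTheory Set

lemma aux_extreme {H α : Type*} [NormedAddCommGroup H] [InnerProductSpace ℝ H] [CompleteSpace H]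
    (x : α → H) (C : α → Set ℝ) (hC : ∀ a, IsClosed (C a))
    (hb : Bornology.IsBounded {h : H | ∀ a, inner ℝ h (x a) ∈ C a})
    (hne : {h : H | ∀ a, inner ℝ h (x a) ∈ C a}.Nonempty) :
    (extremePoints ℝ {h : H | ∀ a, inner ℝ h (x a) ∈ C a}).Nonempty := by
  let K : Set (WeakDual ℝ H) := {l | ∀ a, l (x a) ∈ C a}
  have hK1 : IsClosed K := by
    have : K = ⋂ a, (fun l : WeakDual ℝ H => l (x a)) ⁻¹' C a := by ext; simp [K]
    rw [this]
    exact isClosed_iInter fun a => (hC a).preimage (WeakDual.eval_continuous (x a))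
  have hK2 : IsCompact K := by
    obtain ⟨R, hR⟩ := hb.exists_norm_le
    refine (WeakDual.isCompact_closedBall (𝕜 := ℝ) (E := H) 0 R).of_isClosed_subset hK1 ?_
    intro l hl
    have := hR ((InnerProductSpace.toDual ℝ H).symm (WeakDual.toStrongDual l)) (by
      intro a
      rw [InnerProductSpace.toDual_symm_apply]
      exact hl a)
    rw [LinearIsometryEquiv.norm_map] at this
    simpa using this
  have hK3 : K.Nonempty := by
    obtain ⟨h, hh⟩ := hne
    refine ⟨StrongDual.toWeakDual (InnerProductSpace.toDual ℝ H h), fun a => ?_⟩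
    exact hh a
  have : LocallyConvexSpace ℝ (WeakDual ℝ H) :=
    inferInstanceAs (LocallyConvexSpace ℝ (WeakBilin (topDualPairing ℝ H)))
  obtain ⟨l, hl⟩ := hK2.extremePoints_nonempty hK3
  obtain ⟨h, hh⟩ := (InnerProductSpace.toDual ℝ H).surjective (WeakDual.toStrongDual l)
  have hl' : l = StrongDual.toWeakDual (InnerProductSpace.toDual ℝ H h) := by rw [hh]; rfl
  rw [mem_extremePoints] at hl
  refine ⟨h, ?_⟩
  rw [mem_extremePoints]
  subst hl'
  refine ⟨hl.1, fun y hy z hz hs => ?_⟩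
  have := hl.2 (StrongDual.toWeakDual (InnerProductSpace.toDual ℝ H y)) hy
    (StrongDual.toWeakDual (InnerProductSpace.toDual ℝ H z)) hz (by
      obtain ⟨a, b, ha, hb, hab, he⟩ := hs
      refine ⟨a, b, ha, hb, hab, ?_⟩
      rw [← he]
      simp)
  simpa using this

lemma aux_split {Ω : Type*} {m : MeasurableSpace Ω} (P : Measure Ω)
    (hat : ∀ A : Set Ω, MeasurableSet A → 0 < P A →
      ∃ B : Set Ω, MeasurableSet B ∧ B ⊆ A ∧ 0 < P B ∧ P B < P A) (n : ℕ) :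
    ∀ D : Set Ω, MeasurableSet D → 0 < P D → ∃ B : Fin n → Set Ω, (∀ i, MeasurableSet (B i)) ∧
      (∀ i, B i ⊆ D) ∧ (∀ i, 0 < P (B i)) ∧ Pairwise (Function.onFun Disjoint B) := by
  induction n with
  | zero => intro D _ _; exact ⟨fun _ => ∅, by simp, by simp, by simp, fun i => i.elim0⟩
  | succ n ih =>
    intro D hD hpos
    obtain ⟨B, hB, hBD, hB0, hB1⟩ := hat D hD hpos
    obtain ⟨B', h1, h2, h3, h4⟩ := ih B hB hB0
    have hpos' : 0 < P (D \ B) := by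
      rw [measure_sdiff hBD hB.nullMeasurableSet (hB1.ne_top)]
      exact tsub_pos_of_lt hB1
    have hdis : ∀ i, Disjoint (D \ B) (B' i) := fun i =>
      Set.disjoint_sdiff_left.mono_right (h2 i)
    refine ⟨Fin.cons (D \ B) B', ?_, ?_, ?_, ?_⟩
    · intro i; refine Fin.cases ?_ (fun i => ?_) i
      · exact hD.diff hB
      · exact h1 i
    · intro i; refine Fin.cases ?_ (fun i => ?_) i
      · exact Set.sdiff_subset
      · exact (h2 i).trans hBD
    · intro i; refine Fin.cases ?_ (fun i => ?_) i
      · exact hpos'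
      · exact h3 i
    · intro i j
      refine Fin.cases ?_ (fun i => ?_) i <;> refine Fin.cases ?_ (fun j => ?_) j
      · simp
      · intro _; exact hdis j
      · intro _; exact (hdis i).symm
      · intro hij; exact h4 (i := i) (j := j) (fun h : i = j => hij (congrArg _ h))

/-- nonzero bounded function supported on D orthogonal to finitely many functions -/
lemma aux_perturb {Ω ι : Type*} [Finite ι] {m : MeasurableSpace Ω} (P : Measure Ω)
    [IsFiniteMeasure P]
    (hat : ∀ A : Set Ω, MeasurableSet A → 0 < P A →
      ∃ B : Set Ω, MeasurableSet B ∧ B ⊆ A ∧ 0 < P B ∧ P B < P A)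
    (ψ : ι → Ω → ℝ) (hψ : ∀ i, Integrable (ψ i) P)
    (D : Set Ω) (hD : MeasurableSet D) (hpos : 0 < P D) (ε : ℝ) (hε : 0 < ε) :
    ∃ u : Ω → ℝ, Measurable u ∧ (∀ ω, |u ω| ≤ ε) ∧ (∀ ω, ω ∉ D → u ω = 0) ∧
      ¬ (u =ᵐ[P] 0) ∧ ∀ i, ∫ ω, u ω * ψ i ω ∂P = 0 := by
  classical
  have := Fintype.ofFinite ι
  set n := Fintype.card ι + 1
  obtain ⟨B, h1, h2, h3, h4⟩ := aux_split P hat n D hD hpos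
  let L : (Fin n → ℝ) →ₗ[ℝ] (ι → ℝ) := LinearMap.pi fun i =>
    ∑ k, (∫ ω in B k, ψ i ω ∂P) • LinearMap.proj k
  have hk : LinearMap.ker L ≠ ⊥ := LinearMap.ker_ne_bot_of_finrank_lt (by simp [n])
  obtain ⟨a, ha, ha0⟩ := (Submodule.ne_bot_iff _).1 hk
  have ha' : ∀ i, ∑ k, (∫ ω in B k, ψ i ω ∂P) * a k = 0 := by
    intro i
    have := congrFun (LinearMap.mem_ker.1 ha) i
    simpa [L] using this
  obtain ⟨k0, hk0⟩ : ∃ k, a k ≠ 0 := by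
    by_contra h; push Not at h; exact ha0 (funext h)
  have hna : 0 < ‖a‖ := norm_pos_iff.2 ha0
  set c := ε / ‖a‖ with hc
  have hc0 : 0 < c := div_pos hε hna
  let u : Ω → ℝ := fun ω => ∑ k, (B k).indicator (fun _ => c * a k) ω
  have hu_on : ∀ k, ∀ ω ∈ B k, u ω = c * a k := by
    intro k ω hω
    simp only [u]
    rw [Finset.sum_eq_single k]
    · simp [hω]
    · intro j _ hj
      have := Set.disjoint_left.1 (h4 hj.symm) hω
      simp [this]
    · simp
  have hu_off : ∀ ω, (∀ k, ω ∉ B k) → u ω = 0 := by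
    intro ω h
    simp only [u]
    exact Finset.sum_eq_zero fun k _ => by simp [h k]
  refine ⟨u, ?_, ?_, ?_, ?_, ?_⟩
  · exact Finset.measurable_sum _ fun k _ => measurable_const.indicator (h1 k)
  · intro ω
    by_cases h : ∃ k, ω ∈ B k
    · obtain ⟨k, hk⟩ := h
      rw [hu_on k ω hk, abs_mul, abs_of_pos hc0]
      calc c * |a k| ≤ c * ‖a‖ := by
            gcongr; exact norm_le_pi_norm a k
        _ = ε := by rw [hc]; field_simp
    · push Not at h
      rw [hu_off ω h]; simpa using hε.le
  · intro ω hω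
    exact hu_off ω fun k hk => hω (h2 k hk)
  · intro h
    have : P (B k0) = 0 := by
      refine measure_mono_null ?_ (ae_iff.1 h)
      intro ω hω
      simp [hu_on k0 ω hω, hc0.ne', hk0]
    exact (h3 k0).ne' this
  · intro i
    have : ∀ ω, u ω * ψ i ω = ∑ k, (B k).indicator (fun ω => (c * a k) * ψ i ω) ω := by
      intro ω
      simp only [u]
      rw [Finset.sum_mul]
      refine Finset.sum_congr rfl fun k _ => ?_
      by_cases h : ω ∈ B k <;> simp [h]
    simp_rw [this]
    rw [integral_finsetSum _ fun k _ => ((hψ i).const_mul _).indicator (h1 k)]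
    simp_rw [integral_indicator (h1 _), integral_const_mul]
    have := congrArg (c * ·) (ha' i)
    simp only [mul_zero, Finset.mul_sum] at this
    rw [← this]
    refine Finset.sum_congr rfl fun k _ => by ring

lemma aux_lyap {Ω ι : Type*} [Finite ι] {m : MeasurableSpace Ω} (P : Measure Ω)
    [IsFiniteMeasure P]
    (hat : ∀ A : Set Ω, MeasurableSet A → 0 < P A →
      ∃ B : Set Ω, MeasurableSet B ∧ B ⊆ A ∧ 0 < P B ∧ P B < P A)
    (ψ : ι → Ω → ℝ) (hψ : ∀ i, MemLp (ψ i) 2 P)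
    (f : Ω → ℝ) (hf : Measurable f) (hf0 : ∀ ω, 0 ≤ f ω) (hf1 : ∀ ω, f ω ≤ 1) :
    ∃ A : Set Ω, MeasurableSet A ∧ ∀ i, ∫ ω in A, ψ i ω ∂P = ∫ ω, f ω * ψ i ω ∂P := by
  classical
  let x : {A : Set Ω // MeasurableSet A} ⊕ ι → Lp ℝ 2 P :=
    Sum.elim (fun A => indicatorConstLp 2 A.2 (measure_ne_top P _) 1) (fun i => (hψ i).toLp _)
  let C : {A : Set Ω // MeasurableSet A} ⊕ ι → Set ℝ :=
    Sum.elim (fun A => Icc 0 (P.real A.1)) (fun i => {∫ ω, f ω * ψ i ω ∂P})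
  have hC : ∀ a, IsClosed (C a) := by
    rintro (A | i)
    · exact isClosed_Icc
    · exact isClosed_singleton
  have hmem : ∀ h : Lp ℝ 2 P, (∀ a, inner ℝ h (x a) ∈ C a) ↔
      ((0 ≤ᵐ[P] h) ∧ (h ≤ᵐ[P] fun _ => (1 : ℝ)) ∧
        ∀ i, ∫ ω, h ω * ψ i ω ∂P = ∫ ω, f ω * ψ i ω ∂P) := by
    intro h
    have hint : Integrable h P := (Lp.memLp h).integrable (by norm_num)
    have e1 : ∀ A : {A : Set Ω // MeasurableSet A}, inner ℝ h (x (.inl A)) = ∫ ω in A.1, h ω ∂P := by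
      intro A
      rw [real_inner_comm]
      exact L2.inner_indicatorConstLp_one A.2 (measure_ne_top P _) h
    have e2 : ∀ i, inner ℝ h (x (.inr i)) = ∫ ω, h ω * ψ i ω ∂P := by
      intro i
      rw [L2.inner_def]
      refine integral_congr_ae ?_
      filter_upwards [(hψ i).coeFn_toLp] with ω hω
      simp only [x, Sum.elim_inr, hω]
      simp [mul_comm]
    constructor
    · intro H
      refine ⟨?_, ?_, ?_⟩
      · refine ae_nonneg_of_forall_setIntegral_nonneg hint fun s hs _ => ?_
        rw [← e1 ⟨s, hs⟩]
        exact (H (.inl ⟨s, hs⟩)).1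
      · refine ae_le_of_forall_setIntegral_le hint (integrable_const _) fun s hs _ => ?_
        rw [← e1 ⟨s, hs⟩]
        simpa using (H (.inl ⟨s, hs⟩)).2
      · intro i
        rw [← e2 i]; exact H (.inr i)
    · rintro ⟨H1, H2, H3⟩ (A | i)
      · rw [e1]
        refine ⟨setIntegral_nonneg_of_ae H1, ?_⟩
        have := setIntegral_mono_ae (s := A.1) hint.integrableOn
          (integrable_const (1 : ℝ)).integrableOn H2
        simpa using this
      · rw [e2]; exact H3 i
  have hb : Bornology.IsBounded {h : Lp ℝ 2 P | ∀ a, inner ℝ h (x a) ∈ C a} := by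
    refine isBounded_iff_forall_norm_le.2 ⟨‖indicatorConstLp 2 MeasurableSet.univ
      (measure_ne_top P univ) (1 : ℝ)‖, fun h hh => ?_⟩
    obtain ⟨h1, h2, -⟩ := (hmem h).1 hh
    refine Lp.norm_le_norm_of_ae_le ?_
    filter_upwards [h1, h2, indicatorConstLp_coeFn (p := 2) (hs := MeasurableSet.univ)
      (hμs := measure_ne_top P univ) (c := (1 : ℝ))] with ω a b c
    rw [c]
    simp only [Pi.zero_apply] at a
    simp [abs_of_nonneg a, b]
  have hfL : MemLp f 2 P := MemLp.of_bound hf.aestronglyMeasurable 1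
    (ae_of_all _ fun ω => by rw [Real.norm_of_nonneg (hf0 ω)]; exact hf1 ω)
  have hne : {h : Lp ℝ 2 P | ∀ a, inner ℝ h (x a) ∈ C a}.Nonempty := by
    refine ⟨hfL.toLp f, (hmem _).2 ⟨?_, ?_, fun i => ?_⟩⟩
    · filter_upwards [hfL.coeFn_toLp] with ω h; rw [h]; exact hf0 ω
    · filter_upwards [hfL.coeFn_toLp] with ω h; rw [h]; exact hf1 ω
    · refine integral_congr_ae ?_
      filter_upwards [hfL.coeFn_toLp] with ω h; rw [h]
  obtain ⟨h, hext⟩ := aux_extreme x C hC hb hne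
  rw [mem_extremePoints] at hext
  obtain ⟨hK, hext⟩ := hext
  obtain ⟨h1, h2, h3⟩ := (hmem h).1 hK
  have hhm : Measurable h := (Lp.stronglyMeasurable h).measurable
  have hprodint : ∀ (g : Ω → ℝ), MemLp g 2 P → ∀ i, Integrable (fun ω => g ω * ψ i ω) P :=
    fun g hg i => hg.integrable_mul (hψ i)
  -- h takes values in {0,1}
  have key : ∀ k : ℕ, P {ω | 1 / ((k : ℝ) + 1) ≤ h ω ∧ h ω ≤ 1 - 1 / ((k : ℝ) + 1)} = 0 := by
    intro k
    set ε : ℝ := 1 / ((k : ℝ) + 1) with hε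
    have hε0 : 0 < ε := by positivity
    by_contra hne0
    have hD : MeasurableSet {ω | ε ≤ h ω ∧ h ω ≤ 1 - ε} :=
      (measurableSet_le measurable_const hhm).inter (measurableSet_le hhm measurable_const)
    obtain ⟨u, hu, hub, hus, hu0, hui⟩ := aux_perturb P hat ψ
      (fun i => (hψ i).integrable (by norm_num)) _ hD (pos_iff_ne_zero.2 hne0) ε hε0
    have huL : MemLp u 2 P := MemLp.of_bound hu.aestronglyMeasurable ε (ae_of_all _ hub)
    have hbd : ∀ ω, 0 ≤ h ω → h ω ≤ 1 →
        (0 ≤ h ω + u ω ∧ h ω + u ω ≤ 1) ∧ (0 ≤ h ω - u ω ∧ h ω - u ω ≤ 1) := by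
      intro ω a b
      have hu' := abs_le.1 (hub ω)
      by_cases hω : ω ∈ {ω | ε ≤ h ω ∧ h ω ≤ 1 - ε}
      · obtain ⟨c, d⟩ := hω
        refine ⟨⟨?_, ?_⟩, ?_, ?_⟩ <;> linarith
      · rw [hus ω hω]; simp [a, b]
    have hp : h + huL.toLp u ∈ {h : Lp ℝ 2 P | ∀ a, inner ℝ h (x a) ∈ C a} := by
      have ae1 : ∀ᵐ ω ∂P, (h + huL.toLp u) ω = h ω + u ω := by
        filter_upwards [Lp.coeFn_add h (huL.toLp u), huL.coeFn_toLp] with ω a b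
        rw [a, Pi.add_apply, b]
      refine (hmem _).2 ⟨?_, ?_, fun i => ?_⟩
      · filter_upwards [ae1, h1, h2] with ω a b c
        rw [a]; exact (hbd ω b c).1.1
      · filter_upwards [ae1, h1, h2] with ω a b c
        rw [a]; exact (hbd ω b c).1.2
      · rw [← h3 i, integral_congr_ae (g := fun ω => h ω * ψ i ω + u ω * ψ i ω)]
        · rw [integral_add (hprodint _ (Lp.memLp h) i) (hprodint _ huL i), hui, add_zero]
        · filter_upwards [ae1] with ω a
          rw [a]; ring
    have hm : h - huL.toLp u ∈ {h : Lp ℝ 2 P | ∀ a, inner ℝ h (x a) ∈ C a} := by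
      have ae1 : ∀ᵐ ω ∂P, (h - huL.toLp u) ω = h ω - u ω := by
        filter_upwards [Lp.coeFn_sub h (huL.toLp u), huL.coeFn_toLp] with ω a b
        rw [a, Pi.sub_apply, b]
      refine (hmem _).2 ⟨?_, ?_, fun i => ?_⟩
      · filter_upwards [ae1, h1, h2] with ω a b c
        rw [a]; exact (hbd ω b c).2.1
      · filter_upwards [ae1, h1, h2] with ω a b c
        rw [a]; exact (hbd ω b c).2.2
      · rw [← h3 i, integral_congr_ae (g := fun ω => h ω * ψ i ω - u ω * ψ i ω)]
        · rw [integral_sub (hprodint _ (Lp.memLp h) i) (hprodint _ huL i), hui, sub_zero]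
        · filter_upwards [ae1] with ω a
          rw [a]; ring
    have := (hext _ hp _ hm ⟨1/2, 1/2, by norm_num, by norm_num, by norm_num, by
      rw [← smul_add, add_add_sub_cancel, ← two_smul ℝ h, smul_smul]; norm_num⟩).1
    have hz : huL.toLp u = 0 := by simpa using this
    apply hu0
    filter_upwards [huL.coeFn_toLp, Lp.coeFn_zero ℝ 2 P] with ω a b
    rw [← a, hz, b]
  have h01 : ∀ᵐ ω ∂P, h ω = 0 ∨ h ω = 1 := by
    have : ∀ᵐ ω ∂P, ∀ k : ℕ, ¬ (1 / ((k : ℝ) + 1) ≤ h ω ∧ h ω ≤ 1 - 1 / ((k : ℝ) + 1)) := by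
      rw [ae_all_iff]
      intro k
      rw [ae_iff]
      simpa using key k
    filter_upwards [this, h1, h2] with ω a b c
    by_contra hcon
    push Not at hcon
    have b' : 0 < h ω := lt_of_le_of_ne b (Ne.symm hcon.1)
    have c' : h ω < 1 := lt_of_le_of_ne c hcon.2
    obtain ⟨k, hk⟩ := exists_nat_one_div_lt (lt_min b' (sub_pos.2 c'))
    obtain ⟨k1, k2⟩ := lt_min_iff.1 hk
    exact a k ⟨k1.le, by linarith⟩
  have hAm : MeasurableSet {ω | h ω = 1} := hhm (measurableSet_singleton 1)
  refine ⟨{ω | h ω = 1}, hAm, fun i => ?_⟩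
  rw [← h3 i, ← integral_indicator hAm]
  refine integral_congr_ae ?_
  filter_upwards [h01] with ω hω
  rcases hω with hω | hω <;> simp [indicator, hω]

open scoped ENNReal

lemma aux_mm {Ω : Type*} {m : MeasurableSpace Ω} {g d : Ω → ℝ≥0∞} (hg : Measurable g)
    (hd : Measurable d) : Measurable (fun ω => g ω * d ω) := hg.mul hd

lemma aux_bdd {Ω : Type*} {m : MeasurableSpace Ω} (P : Measure Ω) [IsFiniteMeasure P]
    (d f : Ω → ℝ≥0∞) (hd : Measurable d) (M : ℝ≥0∞) (hM : M ≠ ∞) (hdM : ∀ ω, d ω ≤ M)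
    (hf : Measurable f) (hf1 : ∀ ω, f ω ≤ 1) (A : Set Ω) (hA : MeasurableSet A)
    (h : ∫ ω in A, (d ω).toReal ∂P = ∫ ω, (f ω).toReal * (d ω).toReal ∂P) :
    ∫⁻ ω, A.indicator 1 ω * d ω ∂P = ∫⁻ ω, f ω * d ω ∂P ∧
    ∫⁻ ω, Aᶜ.indicator 1 ω * d ω ∂P = ∫⁻ ω, (1 - f ω) * d ω ∂P := by
  have hfin : ∀ g : Ω → ℝ≥0∞, (∀ ω, g ω ≤ 1) → ∫⁻ ω, g ω * d ω ∂P ≠ ∞ := by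
    intro g hg
    have : ∫⁻ ω, g ω * d ω ∂P ≤ ∫⁻ _, M ∂P := lintegral_mono fun ω => by
      calc g ω * d ω ≤ 1 * M := mul_le_mul' (hg ω) (hdM ω)
        _ = M := one_mul _
    refine ne_top_of_le_ne_top ?_ this
    rw [lintegral_const]
    exact ENNReal.mul_ne_top hM (measure_ne_top _ _)
  have hind : ∀ B : Set Ω, ∀ ω, B.indicator (1 : Ω → ℝ≥0∞) ω ≤ 1 := fun B ω =>
    indicator_le_self' (by simp) ω
  have hptfin : ∀ g : Ω → ℝ≥0∞, (∀ ω, g ω ≤ 1) → ∀ ω, g ω * d ω < ∞ := fun g hg ω =>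
    ENNReal.mul_lt_top ((hg ω).trans_lt ENNReal.one_lt_top) ((hdM ω).trans_lt hM.lt_top)
  have hm1 : ∀ B : Set Ω, MeasurableSet B → Measurable (B.indicator (1 : Ω → ℝ≥0∞)) :=
    fun B hB => measurable_one.indicator hB
  have e1 : ∫⁻ ω, A.indicator 1 ω * d ω ∂P = ∫⁻ ω, f ω * d ω ∂P := by
    rw [← ENNReal.toReal_eq_toReal_iff' (hfin _ (hind A)) (hfin _ hf1),
      ← integral_toReal (aux_mm (hm1 A hA) hd).aemeasurable (ae_of_all _ (hptfin _ (hind A))),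
      ← integral_toReal (aux_mm hf hd).aemeasurable (ae_of_all _ (hptfin _ hf1))]
    simp_rw [ENNReal.toReal_mul]
    rw [← h, ← integral_indicator hA]
    congr 1
    ext ω
    by_cases hω : ω ∈ A <;> simp [hω]
  refine ⟨e1, ?_⟩
  have s1 : ∫⁻ ω, A.indicator 1 ω * d ω ∂P + ∫⁻ ω, Aᶜ.indicator 1 ω * d ω ∂P
      = ∫⁻ ω, d ω ∂P := by
    rw [← lintegral_add_left (aux_mm (hm1 A hA) hd)]
    congr 1
    ext ω
    by_cases hω : ω ∈ A <;> simp [hω]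
  have s2 : ∫⁻ ω, f ω * d ω ∂P + ∫⁻ ω, (1 - f ω) * d ω ∂P = ∫⁻ ω, d ω ∂P := by
    rw [← lintegral_add_left (aux_mm hf hd)]
    congr 1
    ext ω
    rw [← add_mul, add_tsub_cancel_of_le (hf1 ω), one_mul]
  rw [e1, ← s2] at s1
  exact (ENNReal.add_right_inj (hfin _ hf1)).1 s1

lemma aux_dens {Ω ι : Type*} [Finite ι] {m : MeasurableSpace Ω} (P : Measure Ω)
    [IsFiniteMeasure P]
    (hat : ∀ A : Set Ω, MeasurableSet A → 0 < P A →
      ∃ B : Set Ω, MeasurableSet B ∧ B ⊆ A ∧ 0 < P B ∧ P B < P A)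
    (D : ι → Ω → ℝ≥0∞) (hD : ∀ i, Measurable (D i))
    (f : Ω → ℝ≥0∞) (hf : Measurable f) (hf1 : ∀ ω, f ω ≤ 1) :
    ∃ A : Set Ω, MeasurableSet A ∧ ∀ i,
      ∫⁻ ω, A.indicator 1 ω * D i ω ∂P = ∫⁻ ω, f ω * D i ω ∂P ∧
      ∫⁻ ω, Aᶜ.indicator 1 ω * D i ω ∂P = ∫⁻ ω, (1 - f ω) * D i ω ∂P := by
  classical
  let S : Option ℕ → Set ℝ≥0∞ := fun o => o.elim {∞} (fun n => Ico (n : ℝ≥0∞) (n + 1))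
  have hS : ∀ o, MeasurableSet (S o) := by
    rintro (_ | n)
    · exact measurableSet_singleton _
    · exact measurableSet_Ico
  have hScov : ∀ x : ℝ≥0∞, ∃ o, x ∈ S o := by
    intro x
    by_cases hx : x = ∞
    · exact ⟨none, hx⟩
    · refine ⟨some ⌊x.toReal⌋₊, ?_, ?_⟩
      · rw [← ENNReal.ofReal_toReal hx, ← ENNReal.ofReal_natCast]
        apply ENNReal.ofReal_le_ofReal
        simpa using Nat.floor_le (ENNReal.toReal_nonneg (a := x))
      · have : x.toReal < ((⌊x.toReal⌋₊ + 1 : ℕ) : ℝ) := by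
          push_cast; exact Nat.lt_floor_add_one _
        have h2 := (ENNReal.lt_ofReal_iff_toReal_lt hx).2 this
        rw [ENNReal.ofReal_natCast] at h2
        exact_mod_cast h2
  have hSdis : ∀ x o o', x ∈ S o → x ∈ S o' → o = o' := by
    rintro x (_ | n) (_ | n') h h'
    · rfl
    · have hx : x = ∞ := h
      have := h'.2
      rw [hx] at this
      exact absurd this (by simp)
    · have hx : x = ∞ := h'
      have := h.2
      rw [hx] at this
      exact absurd this (by simp)
    · have a : (n : ℝ≥0∞) < n' + 1 := h.1.trans_lt h'.2
      have b : (n' : ℝ≥0∞) < n + 1 := h'.1.trans_lt h.2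
      have a' : n < n' + 1 := by exact_mod_cast a
      have b' : n' < n + 1 := by exact_mod_cast b
      congr 1; omega
  let B : (ι → Option ℕ) → Set Ω := fun k => ⋂ i, D i ⁻¹' S (k i)
  have hB : ∀ k, MeasurableSet (B k) := fun k => MeasurableSet.iInter fun i => hD i (hS _)
  have hBcov : ⋃ k, B k = univ := by
    refine eq_univ_of_forall fun ω => ?_
    choose k hk using fun i => hScov (D i ω)
    exact mem_iUnion.2 ⟨k, mem_iInter.2 hk⟩
  have hBeq : ∀ ω k k', ω ∈ B k → ω ∈ B k' → k = k' := by
    intro ω k k' h h'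
    ext1 i
    exact hSdis _ _ _ (mem_iInter.1 h i) (mem_iInter.1 h' i)
  have hBdis : Pairwise (Function.onFun Disjoint B) := by
    intro k k' hkk
    exact Set.disjoint_left.2 fun ω h h' => hkk (hBeq ω k k' h h')
  let c : Option ℕ → ℝ≥0∞ := fun o => o.elim ∞ (fun _ => 1)
  let M : Option ℕ → ℝ≥0∞ := fun o => o.elim 1 (fun n => n + 1)
  let d : (ι → Option ℕ) → ι → Ω → ℝ≥0∞ := fun k i =>
    (B k).indicator ((k i).elim 1 (fun _ => D i))
  have hd : ∀ k i, Measurable (d k i) := by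
    intro k i
    refine Measurable.indicator ?_ (hB k)
    rcases k i with _ | n
    · exact measurable_one
    · exact hD i
  have hM : ∀ o, M o ≠ ∞ := by
    rintro (_ | n)
    · simp [M]
    · simp [M]
  have hdM : ∀ k i ω, d k i ω ≤ M (k i) := by
    intro k i ω
    by_cases hω : ω ∈ B k
    · simp only [d, hω, indicator_of_mem]
      have := mem_iInter.1 hω i
      revert this
      rcases k i with _ | n
      · intro _; simp [M]
      · intro h; exact h.2.le
    · simp [d, hω]
  have hcd : ∀ k i ω, (B k).indicator (D i) ω = c (k i) * d k i ω := by
    intro k i ω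
    by_cases hω : ω ∈ B k
    · simp only [d, hω, indicator_of_mem]
      have := mem_iInter.1 hω i
      revert this
      rcases k i with _ | n
      · intro h
        have h' : D i ω = ∞ := h
        simp [c, h']
      · intro h; simp [c]
    · simp [d, hω]
  have hsum : ∀ g : Ω → ℝ≥0∞, Measurable g → ∀ i,
      ∫⁻ ω, g ω * D i ω ∂P = ∑' k, c (k i) * ∫⁻ ω, g ω * d k i ω ∂P := by
    intro g hg i
    rw [← setLIntegral_univ, ← hBcov, lintegral_iUnion hB hBdis]
    congr 1
    ext k
    rw [← lintegral_indicator (hB k), ← lintegral_const_mul _ (aux_mm hg (hd k i))]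
    congr 1
    ext ω
    rw [mul_left_comm, ← hcd]
    by_cases hω : ω ∈ B k <;> simp [hω]
  have hloc : ∀ k, ∃ A : Set Ω, MeasurableSet A ∧ ∀ i,
      ∫⁻ ω, A.indicator 1 ω * d k i ω ∂P = ∫⁻ ω, f ω * d k i ω ∂P ∧
      ∫⁻ ω, Aᶜ.indicator 1 ω * d k i ω ∂P = ∫⁻ ω, (1 - f ω) * d k i ω ∂P := by
    intro k
    obtain ⟨A, hA, h⟩ := aux_lyap P hat (fun i ω => (d k i ω).toReal)
      (fun i => MemLp.of_bound (hd k i).ennreal_toReal.aestronglyMeasurable (M (k i)).toReal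
        (ae_of_all _ fun ω => by
          rw [Real.norm_of_nonneg ENNReal.toReal_nonneg]
          exact ENNReal.toReal_mono (hM _) (hdM k i ω)))
      (fun ω => (f ω).toReal) hf.ennreal_toReal (fun ω => ENNReal.toReal_nonneg)
      (fun ω => by simpa using ENNReal.toReal_mono ENNReal.one_ne_top (hf1 ω))
    exact ⟨A, hA, fun i => aux_bdd P (d k i) f (hd k i) (M (k i)) (hM _) (hdM k i) hf hf1 A hA (h i)⟩
  choose A' hA' hloc using hloc
  let A : Set Ω := ⋃ k, A' k ∩ B k
  have hA : MeasurableSet A := MeasurableSet.iUnion fun k => (hA' k).inter (hB k)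
  have hAB : ∀ k, ∀ ω ∈ B k, (ω ∈ A ↔ ω ∈ A' k) := by
    intro k ω hω
    constructor
    · intro h
      obtain ⟨k', h1, h2⟩ := mem_iUnion.1 h
      rw [hBeq ω k k' hω h2]; exact h1
    · intro h; exact mem_iUnion.2 ⟨k, h, hω⟩
  refine ⟨A, hA, fun i => ⟨?_, ?_⟩⟩
  · rw [hsum _ (measurable_one.indicator hA), hsum _ hf]
    congr 1; ext k
    rw [← (hloc k i).1]
    congr 2; ext ω
    by_cases hω : ω ∈ B k
    · simp only [indicator, hAB k ω hω]
    · simp [d, hω]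
  · rw [hsum _ (measurable_one.indicator hA.compl), hsum (fun ω => 1 - f ω) (measurable_const.sub hf)]
    congr 1; ext k
    rw [← (hloc k i).2]
    congr 2; ext ω
    by_cases hω : ω ∈ B k
    · simp only [indicator, mem_compl_iff, hAB k ω hω]
    · simp [d, hω]

lemma aux_trim_sfinite {Ω : Type*} {G m0 : MeasurableSpace Ω} (hG : G ≤ m0) (ν : Measure[m0] Ω)
    [SFinite ν] : SFinite (ν.trim hG) := by
  have : ν.trim hG = Measure.sum fun n => (sfiniteSeq ν n).trim hG := by
    refine @Measure.ext _ G _ _ fun s hs => ?_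
    rw [trim_measurableSet_eq hG hs, Measure.sum_apply _ hs]
    conv_lhs => rw [← sum_sfiniteSeq ν]
    rw [Measure.sum_apply _ (hG s hs)]
    simp_rw [trim_measurableSet_eq hG hs]
  rw [this]
  exact @SFinite.mk _ G _ ⟨_, fun n => isFiniteMeasure_trim hG, rfl⟩

lemma aux_sub {Ω ι : Type*} [Finite ι] {G m0 : MeasurableSpace Ω} (hG : G ≤ m0)
    (P : Measure[m0] Ω) [IsFiniteMeasure P]
    (hat : ∀ A : Set Ω, MeasurableSet[G] A → 0 < P A →
      ∃ B : Set Ω, MeasurableSet[G] B ∧ B ⊆ A ∧ 0 < P B ∧ P B < P A)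
    (ν : ι → Measure[m0] Ω) (hs : ∀ i, SFinite (ν i)) (hac : ∀ i, ν i ≪ P)
    (f : Ω → ℝ≥0∞) (hf : Measurable[G] f) (hf1 : ∀ ω, f ω ≤ 1) :
    ∃ A : Set Ω, MeasurableSet[G] A ∧ ∀ i,
      ν i A = ∫⁻ ω, f ω ∂(ν i) ∧ ν i Aᶜ = ∫⁻ ω, (1 - f ω) ∂(ν i) := by
  have hs' : ∀ i, SFinite ((ν i).trim hG) := fun i => aux_trim_sfinite hG (ν i)
  have hP' : IsFiniteMeasure (P.trim hG) := isFiniteMeasure_trim hG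
  have hac' : ∀ i, (ν i).trim hG ≪ P.trim hG := fun i => (hac i).trim hG
  obtain ⟨A, hA, h⟩ := @aux_dens Ω ι _ G (P.trim hG) hP' (by
      intro A hA hpos
      rw [trim_measurableSet_eq hG hA] at hpos
      obtain ⟨B, h1, h2, h3, h4⟩ := hat A hA hpos
      refine ⟨B, h1, h2, ?_, ?_⟩
      · rwa [trim_measurableSet_eq hG h1]
      · rwa [trim_measurableSet_eq hG h1, trim_measurableSet_eq hG hA])
    (fun i => ((ν i).trim hG).rnDeriv (P.trim hG)) (fun i => Measure.measurable_rnDeriv _ _)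
    f hf hf1
  have hw : ∀ i, ∀ g : Ω → ℝ≥0∞, Measurable[G] g →
      ∫⁻ ω, g ω * ((ν i).trim hG).rnDeriv (P.trim hG) ω ∂(P.trim hG) = ∫⁻ ω, g ω ∂(ν i) := by
    intro i g hg
    rw [← lintegral_trim hG hg]
    conv_rhs => rw [← Measure.withDensity_rnDeriv_eq _ _ (hac' i)]
    rw [lintegral_withDensity_eq_lintegral_mul _ (Measure.measurable_rnDeriv _ _) hg]
    simp only [Pi.mul_apply, mul_comm]
  refine ⟨A, hA, fun i => ?_⟩
  have hm1 : ∀ B : Set Ω, MeasurableSet[G] B → Measurable[G] (B.indicator (1 : Ω → ℝ≥0∞)) :=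
    fun B hB => Measurable.indicator (@measurable_one _ _ _ G _) hB
  have hAc : MeasurableSet[G] Aᶜ := hA.compl
  have h1 := (h i).1
  have h2 := (h i).2
  rw [hw i _ (hm1 A hA), hw i _ hf, lintegral_indicator_one (hG _ hA)] at h1
  rw [hw i _ (hm1 Aᶜ hAc), hw i (fun ω => 1 - f ω) (measurable_const.sub hf),
    lintegral_indicator_one (hG _ hAc)] at h2
  exact ⟨h1, h2⟩

lemma aux_ind {Ω ι : Type*} [Finite ι] {m0 : MeasurableSpace Ω} (P : Measure Ω) [IsFiniteMeasure P]
    (ℱ : Filtration ℝ m0) (ν : ℝ → ι → Measure Ω) (hs : ∀ t i, SFinite (ν t i))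
    (hac : ∀ t i, ν t i ≪ P) (𝕋 : Finset ℝ) :
    (∀ t ∈ 𝕋, ∀ A : Set Ω, MeasurableSet[ℱ t] A → 0 < P A →
      ∃ B : Set Ω, MeasurableSet[ℱ t] B ∧ B ⊆ A ∧ 0 < P B ∧ P B < P A) →
    ∀ (f : ℝ → Ω → ℝ≥0∞), (∀ t ∈ 𝕋, Measurable[ℱ t] (f t)) →
    ∀ (E : Set Ω), (∀ t ∈ 𝕋, MeasurableSet[ℱ t] E) →
    (∀ᵐ ω ∂P, ∑ t ∈ 𝕋, f t ω = E.indicator 1 ω) →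
    ∃ A : ℝ → Set Ω, (∀ t ∈ 𝕋, MeasurableSet[ℱ t] (A t)) ∧
      (∀ᵐ ω ∂P, ∑ t ∈ 𝕋, (A t).indicator (1 : Ω → ℝ≥0∞) ω = E.indicator 1 ω) ∧
      ∀ t ∈ 𝕋, ∀ i, ν t i (A t) = ∫⁻ ω, f t ω ∂(ν t i) := by
  classical
  induction 𝕋 using Finset.induction_on_min with
  | empty =>
    intro _ f _ E _ hsum
    exact ⟨fun _ => ∅, by simp, by simpa using hsum, by simp⟩
  | insert t0 S hlt ih =>
    intro hat f hf E hE hsum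
    have ht0 : t0 ∉ S := fun h => lt_irrefl _ (hlt t0 h)
    simp_rw [Finset.sum_insert ht0] at hsum
    let g : Ω → ℝ≥0∞ := fun ω => min (f t0 ω) 1
    have hg : Measurable[ℱ t0] g := (hf t0 (Finset.mem_insert_self _ _)).min measurable_const
    have hg0 : Measurable g := hg.mono (ℱ.le t0) le_rfl
    have hg1 : ∀ ω, g ω ≤ 1 := fun ω => min_le_right _ _
    have hgf : ∀ᵐ ω ∂P, g ω = f t0 ω := by
      filter_upwards [hsum] with ω h
      refine min_eq_left ?_
      calc f t0 ω ≤ f t0 ω + ∑ t ∈ S, f t ω := le_self_add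
        _ = E.indicator 1 ω := h
        _ ≤ 1 := indicator_le_self' (by simp) ω
    have hf0 : ∀ t ∈ S, Measurable (f t) := fun t ht =>
      (hf t (Finset.mem_insert_of_mem ht)).mono (ℱ.le t) le_rfl
    let q : ℝ → Ω → ℝ≥0∞ := fun t ω => f t ω / (1 - g ω)
    have hq : ∀ t ∈ S, Measurable[ℱ t] (q t) := fun t ht =>
      (hf t (Finset.mem_insert_of_mem ht)).div
        (measurable_const.sub (hg.mono (ℱ.mono (hlt t ht).le) le_rfl))
    have hq0 : ∀ t ∈ S, Measurable (q t) := fun t ht => (hq t ht).mono (ℱ.le t) le_rfl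
    let μ : ι ⊕ (S × ι) ⊕ Bool → Measure Ω :=
      Sum.elim (fun i => ν t0 i) (Sum.elim (fun p => (ν p.1 p.2).withDensity (q p.1))
        (fun b => cond b (P.restrict {ω | g ω = 0}) (P.restrict {ω | g ω = 1})))
    have hμs : ∀ j, SFinite (μ j) := by
      rintro (i | p | b)
      · exact hs t0 i
      · have := hs p.1 p.2
        exact inferInstanceAs (SFinite ((ν p.1 p.2).withDensity (q p.1)))
      · cases b
        · exact inferInstanceAs (SFinite (P.restrict {ω | g ω = 1}))
        · exact inferInstanceAs (SFinite (P.restrict {ω | g ω = 0}))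
    have hμac : ∀ j, μ j ≪ P := by
      rintro (i | p | b)
      · exact hac t0 i
      · exact (withDensity_absolutelyContinuous _ _).trans (hac p.1 p.2)
      · cases b
        · exact Measure.absolutelyContinuous_of_le Measure.restrict_le_self
        · exact Measure.absolutelyContinuous_of_le Measure.restrict_le_self
    obtain ⟨A, hA, hAμ⟩ := aux_sub (ℱ.le t0) P (hat t0 (Finset.mem_insert_self _ _)) μ hμs hμac
      g hg hg1
    have hA0 : MeasurableSet A := ℱ.le t0 _ hA
    have n0 : ∀ᵐ ω ∂P, ω ∈ A → g ω ≠ 0 := by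
      have h := (hAμ (.inr (.inr true))).1
      have hm : MeasurableSet {ω | g ω = 0} := hg0 (measurableSet_singleton 0)
      change (P.restrict {ω | g ω = 0}) A = ∫⁻ ω in {ω | g ω = 0}, g ω ∂P at h
      rw [setLIntegral_congr_fun (g := fun _ => 0) hm (fun ω hω => hω), lintegral_zero,
        Measure.restrict_apply hA0] at h
      rw [ae_iff]
      refine measure_mono_null ?_ h
      intro ω hω
      simpa using hω
    have n1 : ∀ᵐ ω ∂P, ω ∉ A → g ω ≠ 1 := by
      have h := (hAμ (.inr (.inr false))).2
      have hm : MeasurableSet {ω | g ω = 1} := hg0 (measurableSet_singleton 1)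
      change (P.restrict {ω | g ω = 1}) Aᶜ = ∫⁻ ω in {ω | g ω = 1}, (1 - g ω) ∂P at h
      rw [setLIntegral_congr_fun (g := fun _ => 0) hm (fun ω hω => by
        have : g ω = 1 := hω
        simp [this]), lintegral_zero, Measure.restrict_apply hA0.compl] at h
      rw [ae_iff]
      refine measure_mono_null ?_ h
      intro ω hω
      simpa using hω
    obtain ⟨A', hA'm, hA's, hA'ν⟩ := ih (fun t ht => hat t (Finset.mem_insert_of_mem ht))
      (fun t ω => Aᶜ.indicator (q t) ω)
      (fun t ht => (hq t ht).indicator (ℱ.mono (hlt t ht).le _ hA).compl)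
      (E \ A) (fun t ht => (hE t (Finset.mem_insert_of_mem ht)).diff
        (ℱ.mono (hlt t ht).le _ hA)) (by
        filter_upwards [hsum, hgf, n1] with ω h1 h2 h3
        by_cases hω : ω ∈ A
        · simp [hω]
        · have h3 := h3 hω
          simp only [mem_compl_iff, hω, not_false_eq_true, indicator_of_mem, q]
          simp_rw [div_eq_mul_inv]
          rw [← Finset.sum_mul, ← div_eq_mul_inv]
          by_cases hωE : ω ∈ E
          · have hne : g ω ≠ ∞ := ne_top_of_le_ne_top ENNReal.one_ne_top (hg1 ω)
            simp only [hωE, indicator_of_mem, Pi.one_apply] at h1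
            have : ∑ t ∈ S, f t ω = 1 - g ω := by
              rw [← h1, ← h2, ENNReal.add_sub_cancel_left hne]
            rw [this, ENNReal.div_self]
            · simp [hω, hωE]
            · exact (tsub_pos_of_lt (lt_of_le_of_ne (hg1 ω) h3)).ne'
            · exact ne_top_of_le_ne_top ENNReal.one_ne_top tsub_le_self
          · simp only [hωE, not_false_eq_true, indicator_of_notMem, add_eq_zero] at h1
            rw [h1.2]; simp [hωE])
    have hne_t : ∀ t ∈ S, t ≠ t0 := fun t ht => (hlt t ht).ne'
    refine ⟨fun t => if t = t0 then A else A' t, ?_, ?_, ?_⟩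
    · intro t ht
      rcases Finset.mem_insert.1 ht with rfl | ht
      · simpa using hA
      · simpa [hne_t t ht] using hA'm t ht
    · filter_upwards [hsum, hgf, n0, hA's] with ω h1 h2 h3 h4
      rw [Finset.sum_insert ht0]
      have : ∑ t ∈ S, (if t = t0 then A else A' t).indicator (1 : Ω → ℝ≥0∞) ω
          = ∑ t ∈ S, (A' t).indicator (1 : Ω → ℝ≥0∞) ω :=
        Finset.sum_congr rfl fun t ht => by rw [if_neg (hne_t t ht)]
      rw [this, h4, if_pos rfl]
      by_cases hω : ω ∈ A
      · by_cases hωE : ω ∈ E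
        · simp [hω, hωE]
        · simp only [hωE, not_false_eq_true, indicator_of_notMem, add_eq_zero] at h1
          exact absurd (h2.trans h1.1) (h3 hω)
      · by_cases hωE : ω ∈ E <;> simp [hω, hωE]
    · intro t ht i
      rcases Finset.mem_insert.1 ht with rfl | ht
      · simp only [if_true]
        have h := (hAμ (.inl i)).1
        change ν t i A = ∫⁻ ω, g ω ∂(ν t i) at h
        rw [h]
        exact lintegral_congr_ae ((hac t i).ae_le hgf)
      · simp only [if_neg (hne_t t ht)]
        rw [hA'ν t ht i, lintegral_indicator hA0.compl, ← withDensity_apply _ hA0.compl]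
        have h := (hAμ (.inr (.inl (⟨t, ht⟩, i)))).2
        change ((ν t i).withDensity (q t)) Aᶜ = ∫⁻ ω, (1 - g ω) ∂((ν t i).withDensity (q t)) at h
        rw [h, lintegral_withDensity_eq_lintegral_mul _ (hq0 t ht)
          (show Measurable (fun ω => 1 - g ω) from measurable_const.sub hg0)]
        refine lintegral_congr_ae ((hac t i).ae_le ?_)
        filter_upwards [hsum, hgf] with ω h1 h2
        simp only [Pi.mul_apply, q]
        by_cases hgω : g ω = 1
        · have hle : f t0 ω + ∑ t ∈ S, f t ω ≤ 1 := h1 ▸ indicator_le_self' (by simp) ω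
          rw [← h2, hgω] at hle
          have hz : ∑ t ∈ S, f t ω = 0 := by
            have : 1 + ∑ t ∈ S, f t ω ≤ 1 + 0 := by simpa using hle
            simpa using (ENNReal.add_le_add_iff_left ENNReal.one_ne_top).1 this
          have := (Finset.sum_eq_zero_iff.1 hz) t ht
          simp [this]
        · exact ENNReal.div_mul_cancel (tsub_pos_of_lt (lt_of_le_of_ne (hg1 ω) hgω)).ne'
            (ne_top_of_le_ne_top ENNReal.one_ne_top tsub_le_self)

lemma aux_int {Ω : Type*} {m : MeasurableSpace Ω} (Q : Measure Ω) (u v : Ω → ℝ)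
    (hu : Measurable u) (hv : Measurable v)
    (h1 : ∫⁻ ω, ENNReal.ofReal (u ω) ∂Q = ∫⁻ ω, ENNReal.ofReal (v ω) ∂Q)
    (h2 : ∫⁻ ω, ENNReal.ofReal (-u ω) ∂Q = ∫⁻ ω, ENNReal.ofReal (-v ω) ∂Q) :
    ∫ ω, u ω ∂Q = ∫ ω, v ω ∂Q := by
  have hn : ∀ w : Ω → ℝ, Measurable w → ∫⁻ ω, ‖w ω‖ₑ ∂Q
      = ∫⁻ ω, ENNReal.ofReal (w ω) ∂Q + ∫⁻ ω, ENNReal.ofReal (-w ω) ∂Q := by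
    intro w hw
    rw [← lintegral_add_left hw.ennreal_ofReal]
    congr 1
    ext ω
    rw [Real.enorm_eq_ofReal_abs]
    rcases le_total 0 (w ω) with h | h
    · rw [abs_of_nonneg h, ENNReal.ofReal_of_nonpos (neg_nonpos.2 h), add_zero]
    · rw [abs_of_nonpos h, ENNReal.ofReal_of_nonpos h, zero_add]
  have hiff : Integrable u Q ↔ Integrable v Q := by
    have heq : ∫⁻ ω, ‖u ω‖ₑ ∂Q = ∫⁻ ω, ‖v ω‖ₑ ∂Q := by rw [hn u hu, hn v hv, h1, h2]
    constructor
    · intro h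
      exact ⟨hv.aestronglyMeasurable, by
        have := h.2; rw [hasFiniteIntegral_iff_enorm] at this ⊢; rwa [← heq]⟩
    · intro h
      exact ⟨hu.aestronglyMeasurable, by
        have := h.2; rw [hasFiniteIntegral_iff_enorm] at this ⊢; rwa [heq]⟩
  by_cases hi : Integrable u Q
  · rw [integral_eq_lintegral_pos_part_sub_lintegral_neg_part hi,
      integral_eq_lintegral_pos_part_sub_lintegral_neg_part (hiff.1 hi), h1, h2]
  · rw [integral_undef hi, integral_undef (fun h => hi (hiff.2 h))]

/-- Lemma 1 of the paper.  Under Assumptions 1 and 2, with `(Ω, F_t, P)`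
atomless for each `t` of the finite grid `𝕋 ⊆ (0,T]`, for any randomized stopping density
`(f_t)_{t∈𝕋} ∈ P^∞_𝕋` and any finite subset `S_N ⊆ S` of scenarios, there is a partition
`(A^N_t)_{t∈𝕋} ∈ P_𝕋` with `E^θ[f_t Y_t] = E^θ[1_{A^N_t} Y_t]` for all `t ∈ 𝕋`, `θ ∈ S_N`. -/
theorem stmt_4
    {Ω : Type*} {m0 : MeasurableSpace Ω} (P : Measure Ω) [IsProbabilityMeasure P]
    (T : ℝ) (hT : 0 < T) (ℱ : Filtration ℝ m0)
    (Y : ℝ → Ω → ℝ) (hYadapted : Adapted ℱ Y)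
    (hYrc : ∀ ω t, ContinuousWithinAt (fun s => Y s ω) (Ici t) t)
    {S : Type*} [MetricSpace S] [CompactSpace S] [MeasurableSpace S] [OpensMeasurableSpace S]
    (Pθ : S → Measure Ω) (hprob : ∀ θ, IsProbabilityMeasure (Pθ θ))
    -- Assumption 1
    (hac : ∀ θ, Pθ θ ≪ P)
    -- Assumption 2
    (C : ℝ) (hint : ∀ θ, Integrable (fun ω => ⨆ t : Icc (0:ℝ) T, |Y t ω|) (Pθ θ))
    (hC : ∀ θ, ∫ ω, (⨆ t : Icc (0:ℝ) T, |Y t ω|) ∂(Pθ θ) < C)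
    -- the finite time grid
    (𝕋 : Finset ℝ) (h𝕋 : ∀ t ∈ 𝕋, 0 < t ∧ t ≤ T) (hT𝕋 : T ∈ 𝕋)
    -- (Ω, F_t, P) is atomless for every t in the grid
    (hatomless : ∀ t ∈ 𝕋, ∀ A : Set Ω, MeasurableSet[ℱ t] A → 0 < P A →
      ∃ B : Set Ω, MeasurableSet[ℱ t] B ∧ B ⊆ A ∧ 0 < P B ∧ P B < P A)
    -- a randomized stopping density (f_t)_{t ∈ 𝕋} ∈ P^∞_𝕋
    (f : ℝ → Ω → ℝ)
    (hfmeas : ∀ t ∈ 𝕋, StronglyMeasurable[ℱ t] (f t))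
    (hfbdd : ∀ t ∈ 𝕋, ∃ c : ℝ, ∀ᵐ ω ∂P, |f t ω| ≤ c)
    (hfpos : ∀ t ∈ 𝕋, ∀ᵐ ω ∂P, 0 ≤ f t ω)
    (hfsum : ∀ᵐ ω ∂P, ∑ t ∈ 𝕋, f t ω = 1)
    -- a finite subset of scenarios
    (SN : Finset S) :
    ∃ A : ℝ → Set Ω,
      (∀ t ∈ 𝕋, MeasurableSet[ℱ t] (A t)) ∧
      (∀ t ∈ 𝕋, ∀ s ∈ 𝕋, t ≠ s → P (A t ∩ A s) = 0) ∧
      P (⋃ t ∈ 𝕋, A t) = 1 ∧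
      ∀ t ∈ 𝕋, ∀ θ ∈ SN,
        ∫ ω, f t ω * Y t ω ∂(Pθ θ) = ∫ ω, (A t).indicator (fun ω' => Y t ω') ω ∂(Pθ θ) := by
  classical
  let W : ℝ → Bool → Ω → ℝ≥0∞ := fun t b ω => ENNReal.ofReal (cond b (Y t ω) (-Y t ω))
  have hYm : ∀ t, Measurable (Y t) := fun t => (hYadapted t).mono (ℱ.le t) le_rfl
  have hW : ∀ t b, Measurable (W t b) := by
    intro t b
    cases b
    · exact (hYm t).neg.ennreal_ofReal
    · exact (hYm t).ennreal_ofReal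
  let ν : ℝ → (SN × Bool) → Measure Ω := fun t p => (Pθ p.1).withDensity (W t p.2)
  have hνs : ∀ t p, SFinite (ν t p) := by
    intro t p
    have := hprob p.1
    exact inferInstanceAs (SFinite ((Pθ p.1).withDensity (W t p.2)))
  have hνac : ∀ t p, ν t p ≪ P := fun t p =>
    (withDensity_absolutelyContinuous _ _).trans (hac p.1)
  have hpos' : ∀ᵐ ω ∂P, ∀ t ∈ 𝕋, 0 ≤ f t ω := by
    rw [Finset.eventually_all]
    exact hfpos
  obtain ⟨A, hAm, hAs, hAν⟩ := aux_ind P ℱ ν hνs hνac 𝕋 hatomless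
    (fun t ω => ENNReal.ofReal (f t ω))
    (fun t ht => (hfmeas t ht).measurable.ennreal_ofReal) univ (fun t _ => MeasurableSet.univ) (by
      filter_upwards [hpos', hfsum] with ω h1 h2
      rw [← ENNReal.ofReal_sum_of_nonneg h1, h2]
      simp)
  have hAm0 : ∀ t ∈ 𝕋, MeasurableSet (A t) := fun t ht => ℱ.le t _ (hAm t ht)
  refine ⟨A, hAm, ?_, ?_, ?_⟩
  · intro t ht s hs hts
    refine measure_mono_null ?_ (ae_iff.1 hAs)
    rintro ω ⟨h1, h2⟩ heq
    have hle : ∑ u ∈ {t, s}, (A u).indicator (1 : Ω → ℝ≥0∞) ω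
        ≤ ∑ u ∈ 𝕋, (A u).indicator (1 : Ω → ℝ≥0∞) ω :=
      Finset.sum_le_sum_of_subset (by
        intro u hu
        simp only [Finset.mem_insert, Finset.mem_singleton] at hu
        rcases hu with rfl | rfl <;> assumption)
    rw [heq, Finset.sum_pair hts] at hle
    simp only [h1, h2, indicator_of_mem, Pi.one_apply, mem_univ] at hle
    norm_num at hle
  · rw [← measure_univ (μ := P)]
    refine measure_congr ?_
    filter_upwards [hAs] with ω h
    refine eq_true ?_ |>.trans (eq_true (mem_univ ω)).symm
    by_contra hcon
    have : ∑ t ∈ 𝕋, (A t).indicator (1 : Ω → ℝ≥0∞) ω = 0 := by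
      refine Finset.sum_eq_zero fun t ht => indicator_of_notMem (fun hω => hcon ?_) _
      exact mem_iUnion₂.2 ⟨t, ht, hω⟩
    rw [this] at h
    simp at h
  · intro t ht θ hθ
    have hfm : Measurable (f t) := (hfmeas t ht).measurable.mono (ℱ.le t) le_rfl
    have key : ∀ b, ∫⁻ ω in A t, W t b ω ∂(Pθ θ)
        = ∫⁻ ω, W t b ω * ENNReal.ofReal (f t ω) ∂(Pθ θ) := by
      intro b
      have h := hAν t ht (⟨θ, hθ⟩, b)
      change ((Pθ θ).withDensity (W t b)) (A t)
        = ∫⁻ ω, ENNReal.ofReal (f t ω) ∂((Pθ θ).withDensity (W t b)) at h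
      rw [withDensity_apply _ (hAm0 t ht),
        lintegral_withDensity_eq_lintegral_mul _ (hW t b) hfm.ennreal_ofReal] at h
      exact h
    have hfp : ∀ᵐ ω ∂(Pθ θ), 0 ≤ f t ω := (hac θ).ae_le (hfpos t ht)
    refine aux_int (Pθ θ) _ _ (hfm.mul (hYm t)) ((hYm t).indicator (hAm0 t ht)) ?_ ?_
    · have k := key true
      rw [← lintegral_indicator (hAm0 t ht)] at k
      calc _ = ∫⁻ ω, W t true ω * ENNReal.ofReal (f t ω) ∂(Pθ θ) := by
            refine lintegral_congr_ae ?_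
            filter_upwards [hfp] with ω h
            simp only [W, cond_true]
            rw [ENNReal.ofReal_mul h, mul_comm]
        _ = _ := by
            rw [← k]
            congr 1; ext ω
            by_cases hω : ω ∈ A t <;> simp [hω, W]
    · have k := key false
      rw [← lintegral_indicator (hAm0 t ht)] at k
      calc _ = ∫⁻ ω, W t false ω * ENNReal.ofReal (f t ω) ∂(Pθ θ) := by
            refine lintegral_congr_ae ?_
            filter_upwards [hfp] with ω h
            simp only [W, cond_false]
            rw [← mul_neg, ENNReal.ofReal_mul h, mul_comm]
        _ = _ := by
            rw [← k]
            congr 1; ext ω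
            by_cases hω : ω ∈ A t <;> simp [hω, W]
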